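/- arXiv:2104.00104 — 5 statements merged into one kernel-verified Lean document; each statement's English description precedes it below -/
import Mathlib

section
/- Let G = (V,E) be a finite simple undirected graph, let I ⊆ V be an independent set with |I| ≥ 2, and assign to each vertex of I a distinct binary label of length r. For each i ∈ {1,…,r} let A_i (respectively B_i) be the set of vertices of I whose label has i-th bit 0 (respectively 1), and whenever A_i and B_i are both nonempty let C_i be an (A_i,B_i)-separator (C_i arbitrary, e.g. empty, otherwise). Then every connected component of G − ⋃_i C_i contains at most one vertex of I. -/
/-- `C` is an `(A, B)`-separator in `G`: `C` is disjoint from `A ∪ B` and, after deleting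
the vertices of `C`, no vertex of `A` lies in the same connected component as a vertex of
`B` (i.e. every walk from a vertex of `A` to a vertex of `B` meets `C`). -/
def IsSeparator {V : Type*} (G : SimpleGraph V) (A B C : Set V) : Prop :=
  Disjoint C (A ∪ B) ∧
    ∀ a ∈ A, ∀ b ∈ B, ∀ p : G.Walk a b, ∃ w ∈ p.support, w ∈ C

/-- Let `G` be a finite simple undirected graph, `I` an independent set
with `|I| ≥ 2`, and assign to each vertex of `I` a distinct binary label of length `r`.
For each `i`, let `A i` (resp. `B i`) be the vertices of `I` whose label's `i`-th bit is
`0` (resp. `1`), and whenever both are nonempty let `C i` be an `(A i, B i)`-separator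
(`C i` arbitrary otherwise). Then every connected component of `G − ⋃ i, C i` contains at
most one vertex of `I`: if `x, y ∈ I` are joined by a walk avoiding `⋃ i, C i`, then
`x = y`. -/
theorem stmt2 {V : Type*} [Fintype V] [DecidableEq V] (G : SimpleGraph V)
    (I : Set V) (hind : ∀ u ∈ I, ∀ v ∈ I, ¬ G.Adj u v) (hI2 : 2 ≤ I.ncard)
    (r : ℕ) (label : V → Fin r → Bool) (hinj : Set.InjOn label I)
    (A B : Fin r → Set V)
    (hA : ∀ i, A i = {v ∈ I | label v i = false})
    (hB : ∀ i, B i = {v ∈ I | label v i = true})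
    (C : Fin r → Set V)
    (hC : ∀ i, (A i).Nonempty → (B i).Nonempty → IsSeparator G (A i) (B i) (C i))
    (x y : V) (hx : x ∈ I) (hy : y ∈ I)
    (p : G.Walk x y) (hp : ∀ w ∈ p.support, w ∉ ⋃ i, C i) :
    x = y := by
  apply hinj hx hy
  funext i
  have key : ∀ a ∈ I, ∀ b ∈ I, label a i = false → label b i = true →
      ∀ q : G.Walk a b, ∃ w ∈ q.support, w ∈ C i := by
    intro a ha b hb hla hlb q
    have h1 : a ∈ A i := by rw [hA]; exact ⟨ha, hla⟩
    have h2 : b ∈ B i := by rw [hB]; exact ⟨hb, hlb⟩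
    exact (hC i ⟨a, h1⟩ ⟨b, h2⟩).2 a h1 b h2 q
  cases h1 : label x i <;> cases h2 : label y i
  · rfl
  · obtain ⟨w, hw, hwC⟩ := key x hx y hy h1 h2 p
    exact absurd (Set.mem_iUnion.2 ⟨i, hwC⟩) (hp w hw)
  · obtain ⟨w, hw, hwC⟩ := key y hy x hx h2 h1 p.reverse
    rw [SimpleGraph.Walk.support_reverse, List.mem_reverse] at hw
    exact absurd (Set.mem_iUnion.2 ⟨i, hwC⟩) (hp w hw)
  · rfl
end

section
/- Let G = (V,E) be a finite simple undirected graph on n ≥ 3 vertices in which every vertex has degree at least k, and let (L,S,R) be a vertex cut of G with |S| < k. Let S_low = {v ∈ S : deg(v) ≤ 8k} and assume |S_low| ≥ 300·|L|·ln n. Let x ∈ L, let ℓ be a real number with 0 < ℓ ≤ |L|, and let F' = {v ∈ V \ N[x] : |N(v) \ N[x]| ≤ 100·ℓ·ln n}. Then every vertex v ∈ F' has at least |S_low|/2 neighbors in N(x) ∩ S_low. -/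
/-- Let `G` be a finite simple undirected graph on `n ≥ 3` vertices with
minimum degree at least `k`, and let `(L, S, R)` be a vertex cut of `G` with `|S| < k`.
Let `S_low = {v ∈ S : deg v ≤ 8k}` and assume `|S_low| ≥ 300·|L|·ln n`. Let `x ∈ L`, let
`ℓ` be a real number with `0 < ℓ ≤ |L|`, and let
`F' = {v ∈ V \ N[x] : |N(v) \ N[x]| ≤ 100·ℓ·ln n}`. Then every vertex `v ∈ F'` has at
least `|S_low| / 2` neighbors in `N(x) ∩ S_low`. -/
theorem stmt5 {V : Type*} [Fintype V] [DecidableEq V]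
    (G : SimpleGraph V) [DecidableRel G.Adj]
    (n k : ℕ) (hn : n = Fintype.card V) (hn3 : 3 ≤ n)
    (hdeg : ∀ v : V, k ≤ G.degree v)
    (L S R : Finset V)
    (hLS : Disjoint L S) (hLR : Disjoint L R) (hSR : Disjoint S R)
    (hunion : L ∪ S ∪ R = Finset.univ)
    (hL : L.Nonempty) (hR : R.Nonempty)
    (hcut : ∀ u ∈ L, ∀ v ∈ R, ¬ G.Adj u v)
    (hS : S.card < k)
    (Slow : Finset V) (hSlow : Slow = S.filter fun v => G.degree v ≤ 8 * k)
    (hbig : 300 * (L.card : ℝ) * Real.log n ≤ (Slow.card : ℝ))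
    (x : V) (hx : x ∈ L)
    (ℓ : ℝ) (hℓpos : 0 < ℓ) (hℓL : ℓ ≤ (L.card : ℝ)) :
    ∀ v : V, v ∉ insert x (G.neighborFinset x) →
      ((G.neighborFinset v \ insert x (G.neighborFinset x)).card : ℝ) ≤
        100 * ℓ * Real.log n →
      (Slow.card : ℝ) / 2 ≤
        ((G.neighborFinset v ∩ (G.neighborFinset x ∩ Slow)).card : ℝ) := by
  intro v hv hD
  have hlog : (1 : ℝ) ≤ Real.log n := by
    have h3 : (3 : ℝ) ≤ n := by exact_mod_cast hn3
    rw [Real.le_log_iff_exp_le (by linarith)]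
    linarith [Real.exp_one_lt_d9]
  have hxv : ¬ G.Adj v x := by
    intro h
    apply hv
    simp [h.symm]
  have h1 : G.neighborFinset v ⊆ (G.neighborFinset v \ insert x (G.neighborFinset x)) ∪
      (L ∪ (S ∩ (G.neighborFinset v ∩ G.neighborFinset x))) := by
    intro w hw
    have hwu : w ∈ L ∪ S ∪ R := by rw [hunion]; exact Finset.mem_univ w
    have hc := hcut x hx w
    have hwx : w ≠ x := by
      rintro rfl
      exact hxv (by simpa using hw)
    simp only [Finset.mem_union, Finset.mem_inter, Finset.mem_sdiff, Finset.mem_insert,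
      SimpleGraph.mem_neighborFinset] at *
    tauto
  have h2 : Slow ⊆ (S \ (G.neighborFinset v ∩ G.neighborFinset x)) ∪
      (G.neighborFinset v ∩ (G.neighborFinset x ∩ Slow)) := by
    intro w hw
    have hwS : w ∈ S := by
      rw [hSlow] at hw
      exact (Finset.mem_filter.mp hw).1
    simp only [Finset.mem_union, Finset.mem_inter, Finset.mem_sdiff]
    tauto
  have c1 := (Finset.card_le_card h1).trans (Finset.card_union_le _ _)
  have c1' := Finset.card_union_le L (S ∩ (G.neighborFinset v ∩ G.neighborFinset x))
  have c2 := (Finset.card_le_card h2).trans (Finset.card_union_le _ _)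
  have c3 := Finset.card_sdiff_add_card_inter S (G.neighborFinset v ∩ G.neighborFinset x)
  have c4 := hdeg v
  rw [← SimpleGraph.card_neighborFinset_eq_degree] at c4
  have key : Slow.card ≤ (G.neighborFinset v \ insert x (G.neighborFinset x)).card + L.card +
      (G.neighborFinset v ∩ (G.neighborFinset x ∩ Slow)).card := by omega
  have key' : (Slow.card : ℝ) ≤
      ((G.neighborFinset v \ insert x (G.neighborFinset x)).card : ℝ) + (L.card : ℝ) +
      ((G.neighborFinset v ∩ (G.neighborFinset x ∩ Slow)).card : ℝ) := by exact_mod_cast key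
  have e1 : ℓ * Real.log n ≤ (L.card : ℝ) * Real.log n :=
    mul_le_mul_of_nonneg_right hℓL (by linarith)
  have e2 : (L.card : ℝ) ≤ (L.card : ℝ) * Real.log n :=
    le_mul_of_one_le_right (Nat.cast_nonneg _) hlog
  have e3 : (0 : ℝ) ≤ (L.card : ℝ) := Nat.cast_nonneg _
  linarith
end

section
/- Let G = (V,E) be a finite simple undirected graph on n ≥ 3 vertices in which every vertex has degree at least k ≥ 1, and let (L,S,R) be a vertex cut of G with |S| < k. Let S_low = {v ∈ S : deg(v) ≤ 8k} and assume |S_low| ≥ 300·|L|·ln n. Let x ∈ L, let ℓ be a real number with 0 < ℓ ≤ |L|, and let F' = {v ∈ V \ N[x] : |N(v) \ N[x]| ≤ 100·ℓ·ln n}. Then |F'| ≤ 16k. -/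
/-- Let `G` be a finite simple undirected graph on `n ≥ 3` vertices with
minimum degree at least `k ≥ 1`, and let `(L, S, R)` be a vertex cut of `G` with
`|S| < k`. Let `S_low = {v ∈ S : deg v ≤ 8k}` and assume `|S_low| ≥ 300·|L|·ln n`. Let
`x ∈ L`, let `ℓ` be a real number with `0 < ℓ ≤ |L|`, and let
`F' = {v ∈ V \ N[x] : |N(v) \ N[x]| ≤ 100·ℓ·ln n}`. Then `|F'| ≤ 16k`. -/
theorem stmt6 {V : Type*} [Fintype V] [DecidableEq V]
    (G : SimpleGraph V) [DecidableRel G.Adj]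
    (n k : ℕ) (hn : n = Fintype.card V) (hn3 : 3 ≤ n) (hk : 1 ≤ k)
    (hdeg : ∀ v : V, k ≤ G.degree v)
    (L S R : Finset V)
    (hLS : Disjoint L S) (hLR : Disjoint L R) (hSR : Disjoint S R)
    (hunion : L ∪ S ∪ R = Finset.univ)
    (hL : L.Nonempty) (hR : R.Nonempty)
    (hcut : ∀ u ∈ L, ∀ v ∈ R, ¬ G.Adj u v)
    (hS : S.card < k)
    (Slow : Finset V) (hSlow : Slow = S.filter fun v => G.degree v ≤ 8 * k)
    (hbig : 300 * (L.card : ℝ) * Real.log n ≤ (Slow.card : ℝ))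
    (x : V) (hx : x ∈ L)
    (ℓ : ℝ) (hℓpos : 0 < ℓ) (hℓL : ℓ ≤ (L.card : ℝ))
    (F' : Set V)
    (hF' : F' = {v : V | v ∉ insert x (G.neighborFinset x) ∧
      ((G.neighborFinset v \ insert x (G.neighborFinset x)).card : ℝ) ≤
        100 * ℓ * Real.log n}) :
    F'.ncard ≤ 16 * k := by
  classical
  set A : Finset V := insert x (G.neighborFinset x) with hA
  have hlog : (1 : ℝ) ≤ Real.log n := by
    rw [Real.le_log_iff_exp_le (by positivity)]
    have h3 : (3 : ℝ) ≤ n := by exact_mod_cast hn3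
    have := Real.exp_one_lt_d9
    linarith
  have hLpos : 0 < L.card := hL.card_pos
  have hLR1 : (1 : ℝ) ≤ L.card := by exact_mod_cast hLpos
  have h300 : 300 * L.card ≤ Slow.card := by
    have : (300 : ℝ) * L.card ≤ Slow.card := by nlinarith
    exact_mod_cast this
  have hAsub : A ⊆ L ∪ S := by
    intro v hv
    have hu : v ∈ L ∪ S ∪ R := by rw [hunion]; exact Finset.mem_univ v
    rcases Finset.mem_union.1 hu with h | h
    · exact h
    · exfalso
      rcases Finset.mem_insert.1 hv with h1 | h1
      · subst h1
        exact Finset.disjoint_left.1 hLR hx h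
      · exact hcut x hx v h (by simpa using h1)
  have hAcard : k + 1 ≤ A.card := by
    rw [hA, Finset.card_insert_of_notMem (by simp), G.card_neighborFinset_eq_degree]
    have := hdeg x
    omega
  have hUle : (L ∪ S).card ≤ L.card + S.card := Finset.card_union_le _ _
  have hSA : (S \ A).card + A.card ≤ L.card + S.card := by
    rw [← Finset.card_union_of_disjoint Finset.sdiff_disjoint]
    refine le_trans (Finset.card_le_card ?_) hUle
    exact Finset.union_subset (Finset.sdiff_subset.trans Finset.subset_union_right) hAsub
  have hSlowS : Slow ⊆ S := by rw [hSlow]; exact Finset.filter_subset _ _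
  have hF : F' = ((Finset.univ.filter fun v => v ∈ F' : Finset V) : Set V) := by
    ext v; simp
  rw [hF, Set.ncard_coe_finset]
  have key := Finset.card_mul_le_card_mul (s := Finset.univ.filter fun v => v ∈ F') (t := Slow)
    G.Adj (m := (Slow.card + 1) / 2) (n := 8 * k) ?_ ?_
  · have hm : 0 < (Slow.card + 1) / 2 := by omega
    refine Nat.le_of_mul_le_mul_right (key.trans ?_) hm
    have h2 : Slow.card ≤ 2 * ((Slow.card + 1) / 2) := by omega
    calc Slow.card * (8 * k) ≤ (2 * ((Slow.card + 1) / 2)) * (8 * k) :=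
          Nat.mul_le_mul_right _ h2
      _ = 16 * k * ((Slow.card + 1) / 2) := by ring
  · intro v hv
    have hv' : v ∈ F' := by simpa using hv
    rw [hF'] at hv'
    have hc := hv'.2
    have hc3 : 3 * (G.neighborFinset v \ A).card ≤ Slow.card := by
      have : (3 : ℝ) * (G.neighborFinset v \ A).card ≤ Slow.card := by
        have : ℓ * Real.log n ≤ L.card * Real.log n := by gcongr
        linarith
      exact_mod_cast this
    have e1 := Finset.card_inter_add_card_sdiff (G.neighborFinset v) A
    have e2 := Finset.card_inter_add_card_sdiff A (G.neighborFinset v)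
    rw [Finset.inter_comm] at e2
    rw [G.card_neighborFinset_eq_degree] at e1
    have e3 := hdeg v
    have hsub : Slow ⊆ (Slow.bipartiteAbove G.Adj v ∪ S \ A) ∪ A \ G.neighborFinset v := by
      intro w hw
      have := hSlowS hw
      simp only [Finset.mem_union, Finset.mem_sdiff, Finset.mem_bipartiteAbove,
        SimpleGraph.mem_neighborFinset]
      tauto
    have e4 := Finset.card_le_card hsub
    have e5 := Finset.card_union_le (Slow.bipartiteAbove G.Adj v ∪ S \ A) (A \ G.neighborFinset v)
    have e6 := Finset.card_union_le (Slow.bipartiteAbove G.Adj v) (S \ A)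
    omega
  · intro w hw
    rw [hSlow] at hw
    refine le_trans ?_ (Finset.mem_filter.1 hw).2
    rw [← G.card_neighborFinset_eq_degree]
    refine Finset.card_le_card ?_
    intro u hu
    rw [SimpleGraph.mem_neighborFinset]
    exact ((Finset.mem_bipartiteBelow _).1 hu).2.symm
end

section
/- Let G = (V,E) be a finite simple undirected graph and let (L,S,R) be a vertex cut of G that isolates a vertex x in a vertex set T ⊆ V, i.e. L ∩ T = {x}, S ∩ T = ∅, and R ∩ T ≠ ∅. Let I be a maximal independent set of the induced subgraph G[T]. Then (L,S,R) also isolates x in I, i.e. L ∩ I = {x}, S ∩ I = ∅, and R ∩ I ≠ ∅. -/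
/-- Let `G` be a finite simple undirected graph and let `(L, S, R)` be a
vertex cut of `G` (a partition of the vertex set with `L, R` nonempty and no edge between
`L` and `R`) that isolates a vertex `x` in a vertex set `T`, i.e. `L ∩ T = {x}`,
`S ∩ T = ∅` and `R ∩ T ≠ ∅`. Let `I` be a maximal independent set of the induced
subgraph `G[T]`. Then `(L, S, R)` also isolates `x` in `I`: `L ∩ I = {x}`, `S ∩ I = ∅`
and `R ∩ I ≠ ∅`. -/
theorem stmt7 {V : Type*} [Fintype V] (G : SimpleGraph V)
    (L S R : Set V)
    (hLS : Disjoint L S) (hLR : Disjoint L R) (hSR : Disjoint S R)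
    (hunion : L ∪ S ∪ R = Set.univ)
    (hL : L.Nonempty) (hR : R.Nonempty)
    (hcut : ∀ u ∈ L, ∀ v ∈ R, ¬ G.Adj u v)
    (T : Set V) (x : V)
    (hLT : L ∩ T = {x}) (hST : S ∩ T = ∅) (hRT : (R ∩ T).Nonempty)
    (I : Set V) (hIT : I ⊆ T)
    (hind : ∀ u ∈ I, ∀ v ∈ I, ¬ G.Adj u v)
    (hmax : ∀ J : Set V, J ⊆ T → (∀ u ∈ J, ∀ v ∈ J, ¬ G.Adj u v) → I ⊆ J → J = I) :
    L ∩ I = {x} ∧ S ∩ I = ∅ ∧ (R ∩ I).Nonempty := by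
  have key : ∀ v ∈ T, (∀ u ∈ I, ¬ G.Adj v u) → v ∈ I := by
    intro v hv hn
    have h := hmax (insert v I) (Set.insert_subset hv hIT) (by
      rintro a (rfl | ha) b (rfl | hb)
      · exact G.irrefl
      · exact hn b hb
      · exact fun h => hn a ha h.symm
      · exact hind a ha b hb) (Set.subset_insert v I)
    rw [← h]
    exact Set.mem_insert v I
  have hx : x ∈ L ∩ T := by rw [hLT]; rfl
  have hcase : ∀ u ∈ I, u = x ∨ u ∈ R := by
    intro u hu
    have huT := hIT hu
    have : u ∈ L ∪ S ∪ R := by rw [hunion]; trivial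
    rcases this with (h | h) | h
    · left
      have : u ∈ L ∩ T := ⟨h, huT⟩
      rw [hLT] at this
      exact this
    · have : u ∈ S ∩ T := ⟨h, huT⟩
      rw [hST] at this
      exact this.elim
    · exact Or.inr h
  have hxI : x ∈ I := by
    refine key x hx.2 fun u hu => ?_
    rcases hcase u hu with rfl | h
    · exact G.irrefl
    · exact hcut x hx.1 u h
  refine ⟨?_, ?_, ?_⟩
  · apply Set.Subset.antisymm
    · rw [← hLT]
      exact Set.inter_subset_inter_right L hIT
    · rintro _ rfl
      exact ⟨hx.1, hxI⟩
  · apply Set.subset_empty_iff.mp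
    rw [← hST]
    exact Set.inter_subset_inter_right S hIT
  · obtain ⟨r, hrR, hrT⟩ := hRT
    by_contra hne
    have hno : ∀ u ∈ I, u ∉ R := fun u hu h => hne ⟨u, h, hu⟩
    refine hno r (key r hrT fun u hu h => ?_) hrR
    rcases hcase u hu with rfl | h'
    · exact hcut u hx.1 r hrR h.symm
    · exact hno u hu h'
end

section
/- Let G = (V,E) be a finite simple undirected graph with n vertices and m edges such that m ≤ n·k, and let (L,S,R) be a vertex cut of G with |L| ≤ |R| and |L| + |S| ≤ 2k. Let V_low = {v ∈ V : deg(v) ≤ 8k}. Then L ⊆ V_low and |R ∩ V_low| ≥ |L|. -/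
/-- Let `G` be a finite simple undirected graph with `n` vertices and
`m` edges such that `m ≤ n·k`, and let `(L, S, R)` be a vertex cut of `G` with
`|L| ≤ |R|` and `|L| + |S| ≤ 2k`. Let `V_low = {v : deg v ≤ 8k}`. Then `L ⊆ V_low` and
`|R ∩ V_low| ≥ |L|`. -/
theorem stmt8 {V : Type*} [Fintype V] [DecidableEq V]
    (G : SimpleGraph V) [DecidableRel G.Adj]
    (n m k : ℕ) (hn : n = Fintype.card V) (hm : m = G.edgeFinset.card)
    (hmk : m ≤ n * k)
    (L S R : Finset V)
    (hLS : Disjoint L S) (hLR : Disjoint L R) (hSR : Disjoint S R)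
    (hunion : L ∪ S ∪ R = Finset.univ)
    (hL : L.Nonempty) (hR : R.Nonempty)
    (hcut : ∀ u ∈ L, ∀ v ∈ R, ¬ G.Adj u v)
    (hbal : L.card ≤ R.card) (h2k : L.card + S.card ≤ 2 * k)
    (Vlow : Finset V) (hVlow : Vlow = Finset.univ.filter fun v => G.degree v ≤ 8 * k) :
    L ⊆ Vlow ∧ L.card ≤ (R ∩ Vlow).card := by
  subst hVlow
  have hLpos : 0 < L.card := hL.card_pos
  have hk : 0 < k := by omega
  have hcard : L.card + S.card + R.card = n := by
    rw [hn, ← Finset.card_univ, ← hunion, Finset.card_union_of_disjoint,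
      Finset.card_union_of_disjoint hLS]
    rw [Finset.disjoint_union_left]
    exact ⟨hLR, hSR⟩
  constructor
  · intro u hu
    rw [Finset.mem_filter]
    refine ⟨Finset.mem_univ _, ?_⟩
    have hsub : G.neighborFinset u ⊆ L ∪ S := by
      intro v hv
      rw [SimpleGraph.mem_neighborFinset] at hv
      have hv' : v ∈ L ∪ S ∪ R := by rw [hunion]; exact Finset.mem_univ _
      rcases Finset.mem_union.1 hv' with h | h
      · exact h
      · exact absurd hv (hcut u hu v h)
    have h1 := Finset.card_le_card hsub
    rw [SimpleGraph.card_neighborFinset_eq_degree] at h1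
    have h2 := Finset.card_union_le L S
    omega
  · set W := Finset.univ.filter fun v => G.degree v ≤ 8 * k with hW
    by_cases hsmall : n ≤ 8 * k + 1
    · have hall : R ∩ W = R := by
        rw [Finset.inter_eq_left]
        intro v _
        rw [hW, Finset.mem_filter]
        have := G.degree_lt_card_verts v
        exact ⟨Finset.mem_univ _, by omega⟩
      rw [hall]; exact hbal
    · have hsum := G.sum_degrees_eq_twice_card_edges
      have hle : Wᶜ.card * (8 * k) ≤ ∑ v, G.degree v := by
        calc Wᶜ.card * (8 * k) = ∑ v ∈ Wᶜ, 8 * k := by simp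
          _ ≤ ∑ v ∈ Wᶜ, G.degree v := by
            apply Finset.sum_le_sum
            intro v hv
            simp [hW] at hv
            omega
          _ ≤ ∑ v, G.degree v :=
            Finset.sum_le_sum_of_subset (Finset.subset_univ _)
      have h4 : 4 * Wᶜ.card ≤ n := by
        have : (4 * Wᶜ.card) * (2 * k) ≤ n * (2 * k) := by
          rw [hsum, ← hm] at hle
          nlinarith
        exact Nat.le_of_mul_le_mul_right this (by omega)
      have hR' : R.card ≤ (R ∩ W).card + Wᶜ.card := by
        have hsub : R ⊆ (R ∩ W) ∪ Wᶜ := by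
          intro v hv
          by_cases h : v ∈ W <;> simp [hv, h]
        exact (Finset.card_le_card hsub).trans (Finset.card_union_le _ _)
      omega
end
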